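/- Let C ⊂ 𝔸ⁿ be an affine algebraic curve defined over a number field K, S a finite set of places of K containing all infinite places with |S| ≥ 2, and O_S the ring of S-integers. Suppose C has genus 0, C has exactly two points at infinity, both defined over K, and C(O_S) contains a non-singular point. Then C(O_S) is infinite. -/

import Mathlib

open IsDedekindDomain NumberField

set_option synthInstance.maxHeartbeats 1000000
set_option maxHeartbeats 2000000

noncomputable section

/-- A place of a number field `K`: either an infinite (archimedean) place or a finite
place, i.e. a height-one prime of the ring of integers. -/
abbrev NFPlace (K : Type) [Field K] [NumberField K] :=
  NumberField.InfinitePlace K ⊕ IsDedekindDomain.HeightOneSpectrum (NumberField.RingOfIntegers K)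

variable (K : Type) [Field K] [NumberField K]

/-- The finite places belonging to a set `S` of places of `K`. -/
def finPart (S : Finset (NFPlace K)) : Set (HeightOneSpectrum (𝓞 K)) :=
  {v | Sum.inr v ∈ S}

/-- The ring of `S`-integers of `K` (as a subalgebra of `K`): the elements of `K` whose
valuation is at most one at every finite place outside `S`. -/
def SIntegers (S : Finset (NFPlace K)) : Subalgebra (𝓞 K) K :=
  (finPart K S).integer K

/-- A (geometrically integral) affine algebraic curve in `𝔸ⁿ` defined over `K`, given by
an ideal of polynomials over `K` whose extension to the algebraic closure of `K` is prime
and cuts out a one-dimensional variety. -/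
structure AffineCurve (n : ℕ) : Type where
  /-- The ideal of polynomials over `K` vanishing on the curve. -/
  J : Ideal (MvPolynomial (Fin n) K)
  /-- Geometric integrality: the extension of `J` to the algebraic closure is prime. -/
  hprime : (J.map (MvPolynomial.map (algebraMap K (AlgebraicClosure K)))).IsPrime
  /-- The curve is one-dimensional. -/
  hdim : ringKrullDim (MvPolynomial (Fin n) (AlgebraicClosure K) ⧸
      J.map (MvPolynomial.map (algebraMap K (AlgebraicClosure K)))) = 1

namespace AffineCurve

variable {K} {n : ℕ} (C : AffineCurve K n)

/-- The ideal of the curve over the algebraic closure. -/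
def idealBar : Ideal (MvPolynomial (Fin n) (AlgebraicClosure K)) :=
  C.J.map (MvPolynomial.map (algebraMap K (AlgebraicClosure K)))

instance : C.idealBar.IsPrime := C.hprime

/-- The coordinate ring of the curve over the algebraic closure. -/
abbrev CoordRing := MvPolynomial (Fin n) (AlgebraicClosure K) ⧸ C.idealBar

/-- The function field `K̄(C)` of the curve over the algebraic closure of `K`. -/
abbrev FunField := FractionRing C.CoordRing

/-- The coordinate functions `x₁, …, xₙ`, as elements of the function field. -/
def xcoord (i : Fin n) : C.FunField :=
  algebraMap C.CoordRing C.FunField (Ideal.Quotient.mk C.idealBar (MvPolynomial.X i))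

/-- The embedding of the constants `K̄` into the function field. -/
def constMap : AlgebraicClosure K →+* C.FunField :=
  ((algebraMap C.CoordRing C.FunField) : C.CoordRing →+* C.FunField).comp
    ((Ideal.Quotient.mk C.idealBar).comp MvPolynomial.C)

/-- The embedding of `K` into the function field. -/
def constMapK : K →+* C.FunField := C.constMap.comp (algebraMap K (AlgebraicClosure K))

/-- A place of the curve: a nontrivial valuation subring of `K̄(C)` containing the
constants `K̄`. -/
def IsPlace (V : ValuationSubring C.FunField) : Prop :=
  (∀ a : AlgebraicClosure K, C.constMap a ∈ V) ∧ V ≠ ⊤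

/-- A point at infinity of the curve: a place of `K̄(C)` at which at least one of the
coordinate functions admits a pole. -/
def IsPointAtInfinity (V : ValuationSubring C.FunField) : Prop :=
  C.IsPlace V ∧ ∃ i, C.xcoord i ∉ V

/-- The curve has genus `0`: equivalently (the field of constants `K̄` being algebraically
closed), its function field is a rational function field `K̄(t)`. -/
def GenusZero : Prop :=
  ∃ t : C.FunField, Subfield.closure (Set.range C.constMap ∪ {t}) = ⊤

/-- `σ` is an automorphism of `K̄(C)` over `K(C) = K(x₁, …, xₙ)`. -/
def FixesKC (σ : C.FunField ≃+* C.FunField) : Prop :=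
  (∀ a : K, σ (C.constMapK a) = C.constMapK a) ∧ ∀ i, σ (C.xcoord i) = C.xcoord i

/-- A place of `K̄(C)` is defined over `K` if it is fixed by every automorphism of
`K̄(C)` over `K(C)`. -/
def DefinedOverK (V : ValuationSubring C.FunField) : Prop :=
  ∀ σ : C.FunField ≃+* C.FunField, C.FixesKC σ → V.comap σ.toRingHom = V

/-- Two places of `K̄(C)` are conjugate over `K` if some automorphism of `K̄(C)` over
`K(C)` interchanges them. -/
def ConjugateOverK (A B : ValuationSubring C.FunField) : Prop :=
  ∃ σ : C.FunField ≃+* C.FunField, C.FixesKC σ ∧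
    A.comap σ.toRingHom = B ∧ B.comap σ.toRingHom = A

/-- `σ` is an automorphism of `K̄(C)` over `L(C)`, for an intermediate field
`K ⊆ L ⊆ K̄`. -/
def FixesLC (L : IntermediateField K (AlgebraicClosure K)) (σ : C.FunField ≃+* C.FunField) :
    Prop :=
  (∀ a : L, σ (C.constMap a) = C.constMap a) ∧ ∀ i, σ (C.xcoord i) = C.xcoord i

/-- A place of `K̄(C)` is defined over `L` if it is fixed by every automorphism of
`K̄(C)` over `L(C)`. -/
def DefinedOver (L : IntermediateField K (AlgebraicClosure K))
    (V : ValuationSubring C.FunField) : Prop :=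
  ∀ σ : C.FunField ≃+* C.FunField, C.FixesLC L σ → V.comap σ.toRingHom = V

/-- `P` is a `K`-rational point of the curve. -/
def OnCurve (P : Fin n → K) : Prop := ∀ f ∈ C.J, MvPolynomial.eval P f = 0

/-- The set `C(O_S)` of `S`-integral points of the curve: the `K`-rational points all of
whose coordinates are `S`-integers. -/
def SIntegralPoints (S : Finset (NFPlace K)) : Set (Fin n → K) :=
  {P | C.OnCurve P ∧ ∀ i, P i ∈ SIntegers K S}

/-- `P` is a non-singular point of the curve: `P` lies on the curve and the gradients at
`P` of the polynomials vanishing on the curve span a space of dimension `n - 1`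
(Jacobian criterion for a one-dimensional variety). -/
def IsNonsingularPoint (P : Fin n → K) : Prop :=
  C.OnCurve P ∧ Module.finrank K (Submodule.span K
    {g : Fin n → K | ∃ f ∈ C.J, g = fun i => MvPolynomial.eval P (MvPolynomial.pderiv i f)}) =
      n - 1

end AffineCurve

section ConstantValuationSubrings

open Polynomial

variable {k F : Type*} [Field k] [Field F] [Algebra k F]

theorem ValuationSubring.mul_mem_nonunits (V : ValuationSubring F) {x y : F} (hx : x ∈ V)
    (hy : y ∈ V.nonunits) : x * y ∈ V.nonunits := by
  obtain ⟨hy', hy⟩ := V.mem_nonunits_iff_exists_mem_maximalIdeal.1 hy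
  exact V.mem_nonunits_iff_exists_mem_maximalIdeal.2
    ⟨V.mul_mem _ _ hx hy', Ideal.mul_mem_left _ ⟨x, hx⟩ hy⟩

theorem ValuationSubring.mem_of_mul_eq (V : ValuationSubring F) {h x y : F} (hy : y ∉ V.nonunits)
    (hx : x ∈ V) (e : h * y = x) : h ∈ V := by
  rw [ValuationSubring.mem_nonunits_iff_or, not_or, not_not] at hy
  rw [(eq_mul_inv_iff_mul_eq₀ hy.1).2 e]
  exact V.mul_mem _ _ hx hy.2

theorem ValuationSubring.eq_zero_of_algebraMap_mem_nonunits {V : ValuationSubring F}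
    (hV : ∀ c : k, algebraMap k F c ∈ V) {c : k} (hc : algebraMap k F c ∈ V.nonunits) : c = 0 := by
  rcases V.mem_nonunits_iff_or.1 hc with h | h
  · simpa using h
  · exact absurd (by simpa using hV c⁻¹) h

theorem ValuationSubring.notMem_nonunits_of_sub_mem_nonunits {V : ValuationSubring F}
    (hV : ∀ c : k, algebraMap k F c ∈ V) {c : k} (hc : c ≠ 0) {x : F}
    (hx : x - algebraMap k F c ∈ V.nonunits) : x ∉ V.nonunits := fun h =>
  hc (eq_zero_of_algebraMap_mem_nonunits hV (by simpa using V.nonunits.sub_mem h hx))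

theorem ValuationSubring.mem_of_sub_mem_nonunits {V : ValuationSubring F}
    (hV : ∀ c : k, algebraMap k F c ∈ V) {c : k} {x : F}
    (hx : x - algebraMap k F c ∈ V.nonunits) : x ∈ V := by
  simpa using V.add_mem _ _ (V.nonunits_le hx) (hV c)

theorem ValuationSubring.aeval_mem {V : ValuationSubring F}
    (hV : ∀ c : k, algebraMap k F c ∈ V) {s : F} (hs : s ∈ V) (p : k[X]) : aeval s p ∈ V := by
  induction p using Polynomial.induction_on' with
  | add p q hp hq => rw [map_add]; exact V.add_mem _ _ hp hq
  | monomial n a => rw [aeval_monomial]; exact V.mul_mem _ _ (hV a) (pow_mem hs n)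

theorem ValuationSubring.aeval_sub_mem_nonunits {V : ValuationSubring F}
    (hV : ∀ c : k, algebraMap k F c ∈ V) {s : F} {a : k} (hs : s - algebraMap k F a ∈ V.nonunits)
    (p : k[X]) : aeval s p - algebraMap k F (p.eval a) ∈ V.nonunits := by
  obtain ⟨q, hq⟩ := X_sub_C_dvd_sub_C_eval (a := a) (p := p)
  have h := congrArg (aeval s) hq
  simp only [map_sub, map_mul, aeval_X, aeval_C] at h
  rw [h, mul_comm]
  exact V.mul_mem_nonunits (aeval_mem hV (mem_of_sub_mem_nonunits hV hs) q) hs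

theorem ValuationSubring.mvAeval_sub_mem_nonunits {V : ValuationSubring F}
    (hV : ∀ c : k, algebraMap k F c ∈ V) {ι : Type*} {x : ι → F} {P : ι → k}
    (hx : ∀ i, x i - algebraMap k F (P i) ∈ V.nonunits) (p : MvPolynomial ι k) :
    MvPolynomial.aeval x p - algebraMap k F (MvPolynomial.eval P p) ∈ V.nonunits := by
  induction p using MvPolynomial.induction_on with
  | C a => simp [V.nonunits.zero_mem]
  | add p q hp hq =>
    convert V.nonunits.add_mem hp hq using 1
    simp only [map_add]; ring
  | mul_X p i hp =>
    convert V.nonunits.add_mem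
      (V.mul_mem_nonunits (mem_of_sub_mem_nonunits hV (hx i)) hp)
      (V.mul_mem_nonunits (hV (MvPolynomial.eval P p)) (hx i)) using 1
    simp only [map_mul, MvPolynomial.aeval_X, MvPolynomial.eval_X]; ring

/-- A point of a ring mapping to a field is the centre of some valuation subring. -/
theorem exists_valuationSubring_of_ker_le {R L : Type*} [CommRing R] [CommRing L] [Nontrivial L]
    (φ : R →+* F) (ε : R →+* L) (h : ∀ r, φ r = 0 → ε r = 0) :
    ∃ V : ValuationSubring F, (∀ r, φ r ∈ V) ∧ ∀ r, ε r = 0 → φ r ∈ V.nonunits := by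
  have hI : (RingHom.ker ε).map φ.rangeRestrict ≠ ⊤ := by
    rw [Ne, Ideal.eq_top_iff_one, Ideal.mem_map_iff_of_surjective _ φ.rangeRestrict_surjective]
    rintro ⟨r, hr, hr1⟩
    have h1 : φ r = 1 := congrArg Subtype.val hr1
    have := h (r - 1) (by simp [h1])
    rw [map_sub, (hr : ε r = 0)] at this
    simp at this
  obtain ⟨V, hV, hV'⟩ := Ideal.image_subset_nonunits_valuationSubring _ hI
  exact ⟨V, fun r => hV ⟨r, rfl⟩, fun r hr =>
    hV' ⟨φ.rangeRestrict r, Ideal.mem_map_of_mem _ hr, rfl⟩⟩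

theorem exists_isCoprime_mul_aeval_eq {s : F} (hs : IntermediateField.adjoin k {s} = ⊤) (h : F) :
    ∃ p q : k[X], IsCoprime p q ∧ aeval s q ≠ 0 ∧ h * aeval s q = aeval s p := by
  obtain ⟨p, q, hpq⟩ := (IntermediateField.mem_adjoin_simple_iff k h).1
    (hs ▸ IntermediateField.mem_top : h ∈ IntermediateField.adjoin k {s})
  by_cases hq : aeval s q = 0
  · exact ⟨0, 1, isCoprime_zero_left.2 isUnit_one, by simp, by simp [hpq, hq]⟩
  have hq0 : q ≠ 0 := by rintro rfl; simp at hq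
  classical
  let := EuclideanDomain.gcdMonoid k[X]
  obtain ⟨p', q', hp', hq', hu⟩ := extract_gcd p q
  have hqs : aeval s (gcd p q) * aeval s q' = aeval s q := by rw [← map_mul, ← hq']
  have hps : aeval s (gcd p q) * aeval s p' = aeval s p := by rw [← map_mul, ← hp']
  have hgs : aeval s (gcd p q) ≠ 0 := fun h0 => hq (by rw [← hqs, h0, zero_mul])
  have hqs' : aeval s q' ≠ 0 := fun h0 => hq (by rw [← hqs, h0, mul_zero])
  refine ⟨p', q', (gcd_isUnit_iff p' q').1 hu, hqs', ?_⟩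
  rw [hpq, ← hqs, ← hps]
  field_simp

theorem IsCoprime.eval_ne_zero {p q : k[X]} (h : IsCoprime p q) {a : k} (hq : q.eval a = 0) :
    p.eval a ≠ 0 := by
  intro hp
  obtain ⟨u, v, e⟩ := h
  simpa [hp, hq] using congrArg (Polynomial.eval a) e

theorem ValuationSubring.notMem_of_eval_eq_zero {V : ValuationSubring F}
    (hV : ∀ c : k, algebraMap k F c ∈ V) {s : F} {a : k} (hs : s - algebraMap k F a ∈ V.nonunits)
    {p q : k[X]} (hpq : IsCoprime p q) {h : F} (e : h * aeval s q = aeval s p)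
    (hq : q.eval a = 0) : h ∉ V := by
  intro hh
  refine notMem_nonunits_of_sub_mem_nonunits hV (hpq.eval_ne_zero hq)
    (aeval_sub_mem_nonunits hV hs p) ?_
  rw [← e]
  exact V.mul_mem_nonunits hh (by simpa [hq] using aeval_sub_mem_nonunits hV hs q)

theorem ValuationSubring.le_of_sub_mem_nonunits {s : F}
    (hs : IntermediateField.adjoin k {s} = ⊤) {V V' : ValuationSubring F}
    (hV : ∀ c : k, algebraMap k F c ∈ V) (hV' : ∀ c : k, algebraMap k F c ∈ V') {a : k}
    (ha : s - algebraMap k F a ∈ V.nonunits) (ha' : s - algebraMap k F a ∈ V'.nonunits) :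
    V ≤ V' := by
  intro h hh
  obtain ⟨p, q, hpq, hq, e⟩ := exists_isCoprime_mul_aeval_eq hs h
  have hqa : q.eval a ≠ 0 := fun h0 => notMem_of_eval_eq_zero hV ha hpq e h0 hh
  exact V'.mem_of_mul_eq
    (notMem_nonunits_of_sub_mem_nonunits hV' hqa (aeval_sub_mem_nonunits hV' ha' q))
    (aeval_mem hV' (mem_of_sub_mem_nonunits hV' ha') p) e

theorem IntermediateField.adjoin_simple_inv_eq_top {s : F}
    (hs : IntermediateField.adjoin k {s} = ⊤) : IntermediateField.adjoin k {s⁻¹} = ⊤ := by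
  rw [eq_top_iff, ← hs, IntermediateField.adjoin_simple_le_iff]
  simpa using inv_mem (IntermediateField.mem_adjoin_simple_self k s⁻¹)

theorem IntermediateField.adjoin_simple_sub_eq_top {s : F}
    (hs : IntermediateField.adjoin k {s} = ⊤) (a : k) :
    IntermediateField.adjoin k {s - algebraMap k F a} = ⊤ := by
  rw [eq_top_iff, ← hs, IntermediateField.adjoin_simple_le_iff]
  simpa using add_mem (IntermediateField.mem_adjoin_simple_self k (s - algebraMap k F a))
    (IntermediateField.algebraMap_mem _ a)

/-- A generator of a rational function field has exactly one pole. -/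
theorem ValuationSubring.eq_of_generator_notMem {s : F}
    (hs : IntermediateField.adjoin k {s} = ⊤) {V V' : ValuationSubring F}
    (hV : ∀ c : k, algebraMap k F c ∈ V) (hV' : ∀ c : k, algebraMap k F c ∈ V')
    (h : s ∉ V) (h' : s ∉ V') : V = V' := by
  have hs' := IntermediateField.adjoin_simple_inv_eq_top hs
  have key : ∀ W : ValuationSubring F, s ∉ W → s⁻¹ - algebraMap k F 0 ∈ W.nonunits := by
    intro W hW
    rw [map_zero, sub_zero, ValuationSubring.inv_mem_nonunits_iff]
    exact Or.inr hW
  exact le_antisymm (le_of_sub_mem_nonunits hs' hV hV' (key _ h) (key _ h'))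
    (le_of_sub_mem_nonunits hs' hV' hV (key _ h') (key _ h))

theorem ValuationSubring.exists_sub_mem_nonunits [IsAlgClosed k] {s : F}
    (hs : IntermediateField.adjoin k {s} = ⊤) {V : ValuationSubring F}
    (hV : ∀ c : k, algebraMap k F c ∈ V) (htop : V ≠ ⊤) (hsV : s ∈ V) :
    ∃ a : k, s - algebraMap k F a ∈ V.nonunits := by
  by_contra! hcon
  refine htop (_root_.eq_top_iff.2 fun h _ => ?_)
  obtain ⟨p, q, hpq, hq, e⟩ := exists_isCoprime_mul_aeval_eq hs h
  have hq0 : q ≠ 0 := by rintro rfl; simp at hq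
  by_contra hh
  have hqV : aeval s q ∈ V.nonunits := by
    by_contra hn
    exact hh (V.mem_of_mul_eq hn (aeval_mem hV hsV p) e)
  have hsplit := (IsAlgClosed.splits q).eq_prod_roots
  rw [hsplit, map_mul, map_multiset_prod, aeval_C, ValuationSubring.mem_nonunits_iff, map_mul,
    map_multiset_prod, Multiset.map_map, Multiset.map_map, Multiset.prod_eq_one, mul_one,
    ← ValuationSubring.mem_nonunits_iff] at hqV
  · exact hq0 (leadingCoeff_eq_zero.1 (eq_zero_of_algebraMap_mem_nonunits hV hqV))
  · intro x hx
    obtain ⟨a, -, rfl⟩ := Multiset.mem_map.1 hx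
    refine le_antisymm ?_ ?_
    · simpa [ValuationSubring.valuation_le_one_iff] using V.sub_mem hsV (hV a)
    · simpa [ValuationSubring.mem_nonunits_iff] using hcon a

/-- A rational function field has a coordinate with a pole at one given place and a zero at
another. -/
theorem exists_generator_pole_zero [IsAlgClosed k] {s : F}
    (hs : IntermediateField.adjoin k {s} = ⊤) {A B : ValuationSubring F}
    (hA : ∀ c : k, algebraMap k F c ∈ A) (hB : ∀ c : k, algebraMap k F c ∈ B)
    (hA' : A ≠ ⊤) (hB' : B ≠ ⊤) (hAB : A ≠ B) :
    ∃ t : F, IntermediateField.adjoin k {t} = ⊤ ∧ t ∉ A ∧ t ∈ B.nonunits := by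
  obtain ⟨r, hr, hrA⟩ : ∃ r : F, IntermediateField.adjoin k {r} = ⊤ ∧ r ∉ A := by
    by_cases hsA : s ∈ A
    · obtain ⟨a, ha⟩ := ValuationSubring.exists_sub_mem_nonunits hs hA hA' hsA
      have hs' := IntermediateField.adjoin_simple_sub_eq_top hs a
      refine ⟨(s - algebraMap k F a)⁻¹, IntermediateField.adjoin_simple_inv_eq_top hs', ?_⟩
      refine (A.mem_nonunits_iff_or.1 ha).resolve_left fun h0 => hA' (_root_.eq_top_iff.2 fun h _ => ?_)
      rw [h0] at hs'
      have hh : h ∈ IntermediateField.adjoin k {(0 : F)} := hs' ▸ IntermediateField.mem_top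
      rw [IntermediateField.adjoin_zero, IntermediateField.mem_bot] at hh
      obtain ⟨c, rfl⟩ := hh
      exact hA c
    · exact ⟨s, hs, hsA⟩
  have hrB : r ∈ B := by
    by_contra hrB
    exact hAB (ValuationSubring.eq_of_generator_notMem hr hA hB hrA hrB)
  obtain ⟨b, hb⟩ := ValuationSubring.exists_sub_mem_nonunits hr hB hB' hrB
  exact ⟨r - algebraMap k F b, IntermediateField.adjoin_simple_sub_eq_top hr b,
    fun h => hrA (by simpa using A.add_mem _ _ h (hA b)), hb⟩

theorem transcendental_of_notMem [IsAlgClosed k] {A : ValuationSubring F}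
    (hA : ∀ c : k, algebraMap k F c ∈ A) {t : F} (ht : t ∉ A) : Transcendental k t := by
  intro h
  have := IntermediateField.isAlgebraic_adjoin_simple (K := k) h.isIntegral
  have hmem := IntermediateField.mem_adjoin_simple_self k t
  rw [IntermediateField.eq_bot_of_isAlgClosed_of_isAlgebraic (IntermediateField.adjoin k {t}),
    IntermediateField.mem_bot] at hmem
  obtain ⟨c, rfl⟩ := hmem
  exact ht (hA c)

theorem exists_valuationSubring_sub_mem_nonunits {t : F} (ht : Transcendental k t) (a : k) :
    ∃ V : ValuationSubring F, (∀ c : k, algebraMap k F c ∈ V) ∧ V ≠ ⊤ ∧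
      t - algebraMap k F a ∈ V.nonunits := by
  obtain ⟨V, hV, hV'⟩ := exists_valuationSubring_of_ker_le (aeval t : k[X] →ₐ[k] F).toRingHom
    (evalRingHom a) fun r hr => by
      rw [(transcendental_iff.1 ht) r hr, map_zero]
  have hta : t - algebraMap k F a ∈ V.nonunits := by
    have := hV' (X - C a) (by simp)
    rwa [AlgHom.toRingHom_eq_coe, RingHom.coe_coe, map_sub, aeval_X, aeval_C] at this
  refine ⟨V, fun c => by simpa using hV (C c), ?_, hta⟩
  rintro rfl
  refine ht ?_
  rcases (ValuationSubring.mem_nonunits_iff_or _).1 hta with h0 | h0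
  · rw [sub_eq_zero.1 h0]
    exact isAlgebraic_algebraMap a
  · exact absurd (ValuationSubring.mem_top _) h0

theorem exists_eq_aeval_of_forall_mem [IsAlgClosed k] {t : F} (ht : Transcendental k t)
    (hgen : IntermediateField.adjoin k {t} = ⊤) {h : F}
    (hh : ∀ V : ValuationSubring F, (∀ c : k, algebraMap k F c ∈ V) → V ≠ ⊤ → t ∈ V → h ∈ V) :
    ∃ p : k[X], h = aeval t p := by
  obtain ⟨p, q, hpq, hq, e⟩ := exists_isCoprime_mul_aeval_eq hgen h
  have hdeg : q.degree = 0 := by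
    by_contra hd
    obtain ⟨a, ha⟩ := IsAlgClosed.exists_root q hd
    obtain ⟨V, hV, hV', hta⟩ := exists_valuationSubring_sub_mem_nonunits ht a
    exact ValuationSubring.notMem_of_eval_eq_zero hV hta hpq e ha
      (hh V hV hV' (ValuationSubring.mem_of_sub_mem_nonunits hV hta))
  rw [eq_C_of_degree_eq_zero hdeg] at e hq
  rw [aeval_C] at e hq
  refine ⟨C (q.coeff 0)⁻¹ * p, ?_⟩
  rw [map_mul, ← e, aeval_C, map_inv₀]
  field_simp

theorem exists_mul_pow_eq_aeval_of_forall_mem [IsAlgClosed k] {t : F} (ht : Transcendental k t)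
    (hgen : IntermediateField.adjoin k {t} = ⊤) {h : F}
    (hh : ∀ V : ValuationSubring F, (∀ c : k, algebraMap k F c ∈ V) → V ≠ ⊤ → t ∈ V →
      t ∉ V.nonunits → h ∈ V) :
    ∃ (N : ℕ) (p : k[X]), h * t ^ N = aeval t p := by
  obtain ⟨p, q, hpq, hq, e⟩ := exists_isCoprime_mul_aeval_eq hgen h
  have hroots : ∀ a ∈ q.roots, a = 0 := by
    intro a ha
    by_contra ha0
    obtain ⟨V, hV, hV', hta⟩ := exists_valuationSubring_sub_mem_nonunits ht a
    exact ValuationSubring.notMem_of_eval_eq_zero hV hta hpq e (isRoot_of_mem_roots ha)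
      (hh V hV hV' (ValuationSubring.mem_of_sub_mem_nonunits hV hta)
        (ValuationSubring.notMem_nonunits_of_sub_mem_nonunits hV ha0 hta))
  have hsplit := (IsAlgClosed.splits q).eq_prod_roots
  rw [Multiset.eq_replicate_card.2 hroots, Multiset.map_replicate, Multiset.prod_replicate,
    C_0, sub_zero] at hsplit
  refine ⟨Multiset.card q.roots, C (q.leadingCoeff)⁻¹ * p, ?_⟩
  rw [hsplit, map_mul, aeval_C, map_pow, aeval_X] at e hq
  have := left_ne_zero_of_mul hq
  rw [map_mul, ← e, aeval_C, map_inv₀]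
  field_simp

/-- A coordinate of a rational function field is determined up to scaling by its pole and its
zero. -/
theorem exists_eq_mul_of_pole_zero [IsAlgClosed k] {A B : ValuationSubring F}
    (hA : ∀ c : k, algebraMap k F c ∈ A) (hB : ∀ c : k, algebraMap k F c ∈ B) {t h : F}
    (ht : IntermediateField.adjoin k {t} = ⊤) (hh : IntermediateField.adjoin k {h} = ⊤)
    (htA : t ∉ A) (hhA : h ∉ A) (htB : t ∈ B.nonunits) (hhB : h ∈ B.nonunits) :
    ∃ c : k, c ≠ 0 ∧ h = algebraMap k F c * t := by
  have htt := transcendental_of_notMem hA htA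
  have poly : ∀ {t h : F}, IntermediateField.adjoin k {t} = ⊤ →
      IntermediateField.adjoin k {h} = ⊤ → t ∉ A → h ∉ A → ∃ p : k[X], h = aeval t p := by
    intro t h ht hh htA hhA
    refine exists_eq_aeval_of_forall_mem (transcendental_of_notMem hA htA) ht
      fun V hV _ htV => ?_
    by_contra hhV
    exact htA (ValuationSubring.eq_of_generator_notMem hh hA hV hhA hhV ▸ htV)
  obtain ⟨p, hp⟩ := poly ht hh htA hhA
  obtain ⟨q, hq⟩ := poly hh ht hhA htA
  have hcomp : q.comp p = X := by
    have h0 := (transcendental_iff.1 htt) (q.comp p - X) (by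
      rw [map_sub, aeval_comp, ← hp, ← hq, aeval_X, sub_self])
    exact sub_eq_zero.1 h0
  have hdeg : p.natDegree = 1 := by
    have := congrArg natDegree hcomp
    rw [natDegree_comp, natDegree_X] at this
    exact Nat.eq_one_of_mul_eq_one_left this
  have hlin := eq_X_add_C_of_natDegree_le_one hdeg.le
  have hc : p.coeff 1 ≠ 0 := by
    rw [← hdeg]
    exact leadingCoeff_ne_zero.2 (by rintro rfl; simp at hdeg)
  rw [hlin] at hp
  simp only [map_add, map_mul, aeval_C, aeval_X] at hp
  have hd : p.coeff 0 = 0 := by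
    refine ValuationSubring.eq_zero_of_algebraMap_mem_nonunits hB ?_
    have := B.nonunits.sub_mem hhB (B.mul_mem_nonunits (hB (p.coeff 1)) htB)
    rwa [hp, add_sub_cancel_left] at this
  exact ⟨_, hc, by rw [hp, hd]; simp⟩

end ConstantValuationSubrings

section SUnits

open Polynomial

variable {K}

theorem mem_SIntegers_iff {S : Finset (NFPlace K)} {x : K} :
    x ∈ SIntegers K S ↔
      ∀ v : HeightOneSpectrum (𝓞 K), Sum.inr v ∉ S → v.valuation K x ≤ 1 :=
  Iff.rfl

/-- A finite place in `S` yields an integral `S`-unit of infinite order, by finiteness of the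
class group. -/
theorem exists_SUnit_of_finite_place {S : Finset (NFPlace K)} {v : HeightOneSpectrum (𝓞 K)}
    (hv : Sum.inr v ∈ S) :
    ∃ α : 𝓞 K, α ≠ 0 ∧ (algebraMap (𝓞 K) K α)⁻¹ ∈ SIntegers K S ∧
      ∀ m : ℕ, 0 < m → α ^ m ≠ 1 := by
  obtain ⟨h, hh, hpr⟩ : ∃ h : ℕ, 0 < h ∧ (v.asIdeal ^ h).IsPrincipal := by
    have hv0 : v.asIdeal ∈ nonZeroDivisors (Ideal (𝓞 K)) := mem_nonZeroDivisors_of_ne_zero v.ne_bot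
    refine ⟨Fintype.card (ClassGroup (𝓞 K)), Fintype.card_pos, ?_⟩
    have := pow_card_eq_one (x := ClassGroup.mk0 ⟨v.asIdeal, hv0⟩)
    rw [← map_pow, ClassGroup.mk0_eq_one_iff] at this
    simpa using this
  obtain ⟨α, hα⟩ := hpr.principal
  replace hα : v.asIdeal ^ h = Ideal.span {α} := hα
  have hα0 : α ≠ 0 := by
    rintro rfl
    rw [Ideal.span_singleton_zero] at hα
    exact v.ne_bot (pow_eq_zero_iff hh.ne' |>.1 hα)
  refine ⟨α, hα0, ?_, ?_⟩
  · rw [mem_SIntegers_iff]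
    intro w hw
    have hαw : α ∉ w.asIdeal := by
      intro hmem
      have hle : v.asIdeal ^ h ≤ w.asIdeal := by
        rw [hα, Ideal.span_singleton_le_iff_mem]; exact hmem
      have hle' := Ideal.IsPrime.le_of_pow_le hle
      have := v.isMaximal.eq_of_le w.isPrime.ne_top hle'
      exact hw (HeightOneSpectrum.ext this ▸ hv)
    rw [map_inv₀, (HeightOneSpectrum.valuation_eq_one_iff_notMem w).2 hαw, inv_one]
  · intro m hm h1
    have hu : IsUnit α := IsUnit.of_pow_eq_one h1 hm.ne'
    rw [Ideal.span_singleton_eq_top.2 hu] at hα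
    exact v.isPrime.ne_top (top_unique (hα.symm.le.trans (Ideal.pow_le_self hh.ne')))

/-- Several infinite places yield a unit of infinite order, by Dirichlet's unit theorem. -/
theorem exists_unit_of_infinite_order (hcard : 2 ≤ Fintype.card (InfinitePlace K)) :
    ∃ α : (𝓞 K)ˣ, ∀ m : ℕ, 0 < m → α ^ m ≠ 1 := by
  have hr : 0 < NumberField.Units.rank K := by
    unfold NumberField.Units.rank; omega
  let i : Fin (NumberField.Units.rank K) := ⟨0, hr⟩
  refine ⟨NumberField.Units.fundSystem K i, fun m hm h1 => ?_⟩
  have htor : NumberField.Units.fundSystem K i ∈ NumberField.Units.torsion K :=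
    (CommGroup.mem_torsion _).2 (isOfFinOrder_iff_pow_eq_one.2 ⟨m, hm, h1⟩)
  classical
  have hlog := NumberField.Units.logEmbedding_fundSystem K i
  rw [(NumberField.Units.dirichletUnitTheorem.logEmbedding_eq_zero_iff).2 htor] at hlog
  exact (NumberField.Units.basisUnitLattice K).ne_zero i (Subtype.ext hlog.symm)

theorem exists_SUnit_of_infinite_order {S : Finset (NFPlace K)}
    (hcard : 2 ≤ S.card) :
    ∃ α : 𝓞 K, α ≠ 0 ∧ (algebraMap (𝓞 K) K α)⁻¹ ∈ SIntegers K S ∧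
      ∀ m : ℕ, 0 < m → α ^ m ≠ 1 := by
  by_cases hfin : ∃ v : HeightOneSpectrum (𝓞 K), Sum.inr v ∈ S
  · obtain ⟨v, hv⟩ := hfin
    exact exists_SUnit_of_finite_place hv
  push Not at hfin
  have hle : S.card ≤ Fintype.card (InfinitePlace K) := by
    classical
    have hsub : S ⊆ Finset.univ.map ⟨Sum.inl, Sum.inl_injective⟩ := by
      rintro (w | v) hw
      · simp
      · exact absurd hw (hfin v)
    simpa using Finset.card_le_card hsub
  obtain ⟨α, hα⟩ := exists_unit_of_infinite_order (K := K) (hcard.trans hle)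
  refine ⟨α, α.ne_zero, ?_, fun m hm h1 => hα m hm (Units.ext (by simpa using h1))⟩
  have : (algebraMap (𝓞 K) K (α : 𝓞 K))⁻¹ = algebraMap (𝓞 K) K ((α⁻¹ : (𝓞 K)ˣ) : 𝓞 K) := by
    rw [inv_eq_iff_eq_inv, ← one_div, eq_div_iff, ← map_mul]
    · simp
    · simp
  rw [this]
  exact Subalgebra.algebraMap_mem _ _

/-- An element of a number ring has a power congruent to `1` modulo any nonzero integer once it
is inverted. -/
theorem exists_pow_sub_one_mem {S : Finset (NFPlace K)} {α : 𝓞 K} (hα0 : α ≠ 0)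
    (hα : (algebraMap (𝓞 K) K α)⁻¹ ∈ SIntegers K S) {d : 𝓞 K} (hd : d ≠ 0) :
    ∃ r : ℕ, 0 < r ∧ ∃ b ∈ SIntegers K S,
      algebraMap (𝓞 K) K α ^ r - 1 = algebraMap (𝓞 K) K d * b := by
  have hfin : Finite (𝓞 K ⧸ Ideal.span {d}) :=
    Ideal.finiteQuotientOfFreeOfNeBot _ (by simpa using hd)
  obtain ⟨i, j, hij, e⟩ := Finite.exists_ne_map_eq_of_infinite
    fun m : ℕ => Ideal.Quotient.mk (Ideal.span {d}) (α ^ m)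
  wlog hlt : i < j generalizing i j
  · exact this j i hij.symm e.symm (by omega)
  obtain ⟨r, rfl⟩ := Nat.exists_eq_add_of_lt hlt
  rw [eq_comm, Ideal.Quotient.eq, Ideal.mem_span_singleton] at e
  obtain ⟨c, hc⟩ := e
  have hα0' : algebraMap (𝓞 K) K α ≠ 0 := by simpa using hα0
  refine ⟨r + 1, Nat.succ_pos r, ((algebraMap (𝓞 K) K α)⁻¹) ^ i * algebraMap (𝓞 K) K c,
    mul_mem (pow_mem hα i) (Subalgebra.algebraMap_mem _ c), ?_⟩
  have hc' := congrArg (algebraMap (𝓞 K) K) hc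
  simp only [map_sub, map_pow, map_mul] at hc'
  rw [mul_left_comm, ← hc', inv_pow, eq_inv_mul_iff_mul_eq₀ (pow_ne_zero _ hα0')]
  ring

/-- A point of an affine curve parametrised by `𝔾ₘ` which is `S`-integral spreads to infinitely
many parameters with `S`-integral values. -/
theorem infinite_setOf_SIntegral_values {S : Finset (NFPlace K)} (hcard : 2 ≤ S.card)
    {ι : Type*} [Finite ι] (p : ι → K[X]) (N : ℕ)
    (hp : ∀ i, (p i).eval 1 ∈ SIntegers K S) :
    {u : K | u ≠ 0 ∧ ∀ i, (p i).eval u * (u⁻¹) ^ N ∈ SIntegers K S}.Infinite := by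
  cases nonempty_fintype ι
  obtain ⟨α, hα0, hα, hord⟩ := exists_SUnit_of_infinite_order hcard
  choose d hdM hd using fun i => IsLocalization.integerNormalization_spec
    (nonZeroDivisors (𝓞 K)) (p i)
  have hd0 : (∏ i, d i) ≠ 0 :=
    Finset.prod_ne_zero_iff.2 fun i _ => nonZeroDivisors.ne_zero (hdM i)
  obtain ⟨r, hr, b, hb, e⟩ := exists_pow_sub_one_mem hα0 hα hd0
  have hα0' : algebraMap (𝓞 K) K α ≠ 0 := by simpa using hα0
  have hord' : ∀ m : ℕ, 0 < m → algebraMap (𝓞 K) K α ^ m ≠ 1 := fun m hm h1 =>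
    hord m hm (FaithfulSMul.algebraMap_injective (𝓞 K) K (by rw [map_pow, h1, map_one]))
  refine Set.infinite_of_injective_forall_mem
    (f := fun m : ℕ => algebraMap (𝓞 K) K α ^ (r * m)) ?_ ?_
  · intro m m' hmm
    have key : ∀ a b : ℕ, a < b →
        algebraMap (𝓞 K) K α ^ (r * a) = algebraMap (𝓞 K) K α ^ (r * b) → False := by
      intro a b hab h
      obtain ⟨c, rfl⟩ := Nat.exists_eq_add_of_lt hab
      refine hord' (r * (c + 1)) (by positivity) ?_
      rw [add_assoc, mul_add, pow_add] at h
      exact mul_left_cancel₀ (pow_ne_zero _ hα0') (by rw [← h, mul_one])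
    rcases lt_trichotomy m m' with h | h | h
    · exact (key _ _ h hmm).elim
    · exact h
    · exact (key _ _ h hmm.symm).elim
  · intro m
    refine ⟨pow_ne_zero _ hα0', fun i => ?_⟩
    set u := algebraMap (𝓞 K) K α ^ (r * m) with hu
    have huS : u ∈ SIntegers K S := pow_mem (Subalgebra.algebraMap_mem _ α) _
    have huS' : u⁻¹ ∈ SIntegers K S := by rw [hu, ← inv_pow]; exact pow_mem hα _
    refine mul_mem ?_ (pow_mem huS' N)
    obtain ⟨b', hb', e'⟩ : ∃ b' ∈ SIntegers K S, u - 1 = algebraMap (𝓞 K) K (d i) * b' := by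
      obtain ⟨c, hc⟩ := Finset.dvd_prod_of_mem (fun i => d i) (Finset.mem_univ i)
      have hg := mul_geom_sum (algebraMap (𝓞 K) K α ^ r) m
      refine ⟨algebraMap (𝓞 K) K c * b *
        ∑ l ∈ Finset.range m, (algebraMap (𝓞 K) K α ^ r) ^ l, ?_, ?_⟩
      · exact mul_mem (mul_mem (Subalgebra.algebraMap_mem _ c) hb)
          (sum_mem fun l _ => pow_mem (pow_mem (Subalgebra.algebraMap_mem _ α) _) _)
      · rw [hu, pow_mul, ← hg, e, hc, map_mul]
        ring
    set q := IsLocalization.integerNormalization (nonZeroDivisors (𝓞 K)) (p i) with hq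
    have hev : ∀ x : K, aeval x q = algebraMap (𝓞 K) K (d i) * (p i).eval x := by
      intro x
      rw [← eval_map_algebraMap, hd i, algebra_compatible_smul K, eval_smul,
        smul_eq_mul]
    have hdi : algebraMap (𝓞 K) K (d i) ≠ 0 := by
      simpa using nonZeroDivisors.ne_zero (hdM i)
    obtain ⟨w, hw⟩ := sub_dvd_eval_sub (⟨u, huS⟩ : SIntegers K S) 1
      (q.map (algebraMap (𝓞 K) (SIntegers K S)))
    have hw' := congrArg (SIntegers K S).val hw
    rw [map_sub, map_mul, map_sub, map_one, eval_map_algebraMap, eval_map_algebraMap,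
      ← aeval_algHom_apply, ← aeval_algHom_apply, map_one] at hw'
    simp only [Subalgebra.coe_val, hev] at hw'
    rw [e', ← mul_sub, mul_assoc] at hw'
    have hw'' := mul_left_cancel₀ hdi hw'
    rw [sub_eq_iff_eq_add] at hw''
    rw [hw'']
    exact add_mem (mul_mem hb' w.2) (hp i)

end SUnits

section JacobianCriterion

variable {k ι : Type*} [Field k] [Fintype ι]

theorem MvPolynomial.sub_linear_part_mem_sq (P : ι → k) (f : MvPolynomial ι k) :
    f - C (eval P f) - ∑ j, C (eval P (pderiv j f)) * (X j - C (P j)) ∈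
      Ideal.span (Set.range fun j => (X j - C (P j) : MvPolynomial ι k)) ^ 2 := by
  classical
  induction f using MvPolynomial.induction_on with
  | C a => simp
  | add p q hp hq =>
    convert add_mem hp hq using 1
    simp only [map_add, add_mul, Finset.sum_add_distrib]
    ring
  | mul_X p i hp =>
    have hX : ∀ j, (X j - C (P j) : MvPolynomial ι k) ∈
        Ideal.span (Set.range fun j => (X j - C (P j) : MvPolynomial ι k)) :=
      fun j => Ideal.subset_span ⟨j, rfl⟩
    have hsum : ∑ j, C (eval P (pderiv j p)) * (X j - C (P j)) ∈
        Ideal.span (Set.range fun j => (X j - C (P j) : MvPolynomial ι k)) :=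
      sum_mem fun j _ => Ideal.mul_mem_left _ _ (hX j)
    have hprod := Ideal.mul_mem_mul (hX i) hsum
    rw [← pow_two] at hprod
    convert add_mem (Ideal.mul_mem_left _ (X i) hp) hprod using 1
    have hd : ∀ j, C (eval P (pderiv j (p * X i))) * (X j - C (P j) : MvPolynomial ι k) =
        C (P i) * (C (eval P (pderiv j p)) * (X j - C (P j))) +
          if i = j then C (eval P p) * (X j - C (P j)) else 0 := by
      intro j
      rw [pderiv_mul, pderiv_X]
      by_cases hij : i = j
      · subst hij
        simp only [map_add, map_mul, eval_X, Pi.single_eq_same, map_one, if_true]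
        ring
      · simp only [map_add, map_mul, eval_X, Pi.single_eq_of_ne hij, map_zero,
          if_neg hij]
        ring
    simp only [hd, Finset.sum_add_distrib, ← Finset.mul_sum, Finset.sum_ite_eq, Finset.mem_univ,
      if_true, map_mul, eval_X]
    ring

theorem MvPolynomial.ker_eval_eq_span (P : ι → k) :
    RingHom.ker (eval P) =
      Ideal.span (Set.range fun j => (X j - C (P j) : MvPolynomial ι k)) := by
  refine le_antisymm (fun f hf => ?_) (Ideal.span_le.2 ?_)
  · have h := Ideal.pow_le_self two_ne_zero (sub_linear_part_mem_sq P f)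
    rw [(hf : eval P f = 0), C_0, sub_zero] at h
    refine (Submodule.sub_mem_iff_left _ (sum_mem fun j _ => ?_)).1 h
    exact Ideal.mul_mem_left _ _ (Ideal.subset_span ⟨j, rfl⟩)
  · rintro _ ⟨j, rfl⟩
    simp [RingHom.mem_ker]

theorem IsLocalRing.maximalIdeal_le_span_singleton {R : Type*} [CommRing R] [IsLocalRing R]
    [IsNoetherianRing R] {y : R}
    (h : IsLocalRing.maximalIdeal R ≤
      Ideal.span {y} ⊔ IsLocalRing.maximalIdeal R * IsLocalRing.maximalIdeal R) :
    IsLocalRing.maximalIdeal R ≤ Ideal.span {y} :=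
  Submodule.le_of_le_smul_of_le_jacobson_bot (IsNoetherian.noetherian _)
    (IsLocalRing.maximalIdeal_le_jacobson ⊥) h

/-- If the gradients at `P` of the polynomials in a prime ideal `I` span a hyperplane, then every
rational function on the zero locus of `I` or its inverse is regular at `P`. -/
theorem regular_or_inv_regular_of_gradients [DecidableEq ι]
    (I : Ideal (MvPolynomial ι k)) [I.IsPrime] (P : ι → k)
    (hP : ∀ f ∈ I, MvPolynomial.eval P f = 0) (e : ι → k)
    (he : ∀ i, ∃ c : k, ∃ f ∈ I,
      Pi.single i 1 = c • e + fun j => MvPolynomial.eval P (MvPolynomial.pderiv j f))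
    (h : FractionRing (MvPolynomial ι k ⧸ I)) :
    ∃ p q : MvPolynomial ι k, MvPolynomial.eval P q ≠ 0 ∧
      (h * algebraMap _ _ (Ideal.Quotient.mk I q) = algebraMap _ _ (Ideal.Quotient.mk I p) ∨
        h * algebraMap _ _ (Ideal.Quotient.mk I p) = algebraMap _ _ (Ideal.Quotient.mk I q)) := by
  let M := RingHom.ker (Ideal.Quotient.lift I (MvPolynomial.eval P) hP)
  have hM : ∀ q, Ideal.Quotient.mk I q ∈ M ↔ MvPolynomial.eval P q = 0 := fun q => by
    rw [RingHom.mem_ker, Ideal.Quotient.lift_mk]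
  have hMprime : M.IsPrime := RingHom.ker_isPrime _
  let z : ι → MvPolynomial ι k ⧸ I := fun j =>
    Ideal.Quotient.mk I (MvPolynomial.X j - MvPolynomial.C (P j))
  have hspan : M = Ideal.span (Set.range z) := by
    have hz : Set.range z = Ideal.Quotient.mk I '' Set.range
        fun j => (MvPolynomial.X j - MvPolynomial.C (P j) : MvPolynomial ι k) := by
      rw [← Set.range_comp]; rfl
    rw [hz, ← Ideal.map_span, ← MvPolynomial.ker_eval_eq_span]
    ext x
    obtain ⟨q, rfl⟩ := Ideal.Quotient.mk_surjective x
    rw [hM]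
    refine ⟨fun hq => Ideal.mem_map_of_mem _ hq, fun hq => ?_⟩
    obtain ⟨r, hr, hrq⟩ := (Ideal.mem_map_iff_of_surjective _ Ideal.Quotient.mk_surjective).1 hq
    rw [← hM, ← hrq, hM]
    exact hr
  let y : MvPolynomial ι k ⧸ I := ∑ j, Ideal.Quotient.mk I (MvPolynomial.C (e j)) * z j
  have hle : M ≤ Ideal.span {y} ⊔ M * M := by
    conv_lhs => rw [hspan]
    rw [Ideal.span_le]
    rintro _ ⟨i, rfl⟩
    obtain ⟨c, f, hf, hv⟩ := he i
    have htaylor := Ideal.mem_map_of_mem (Ideal.Quotient.mk I)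
      (MvPolynomial.sub_linear_part_mem_sq P f)
    rw [hP f hf, Ideal.map_pow, ← MvPolynomial.ker_eval_eq_span, map_sub, map_sub,
      Ideal.Quotient.eq_zero_iff_mem.2 hf, map_zero, map_zero, sub_zero, zero_sub, neg_mem_iff,
      map_sum] at htaylor
    have hMM : (RingHom.ker (MvPolynomial.eval P)).map (Ideal.Quotient.mk I) ^ 2 ≤ M * M := by
      rw [← pow_two M]
      refine Ideal.pow_right_mono (Ideal.map_le_iff_le_comap.2 fun r hr => ?_) 2
      exact (hM r).2 hr
    have hzi : z i = Ideal.Quotient.mk I (MvPolynomial.C c) * y +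
        ∑ j, Ideal.Quotient.mk I (MvPolynomial.C
          (MvPolynomial.eval P (MvPolynomial.pderiv j f)) *
            (MvPolynomial.X j - MvPolynomial.C (P j))) := by
      have hzi' : z i = ∑ j, Ideal.Quotient.mk I
          (MvPolynomial.C ((Pi.single i 1 : ι → k) j)) * z j := by
        rw [Finset.sum_eq_single i]
        · simp
        · intro j _ hj
          simp [Pi.single_eq_of_ne hj]
        · simp
      rw [hzi', hv, Finset.mul_sum, ← Finset.sum_add_distrib]
      refine Finset.sum_congr rfl fun j _ => ?_
      simp only [Pi.add_apply, Pi.smul_apply, smul_eq_mul, map_add, map_mul, z]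
      ring
    rw [SetLike.mem_coe, hzi]
    exact add_mem (Ideal.mem_sup_left (Ideal.mul_mem_left _ _ (Ideal.mem_span_singleton_self y)))
      (Ideal.mem_sup_right (hMM htaylor))
  let O := Localization.AtPrime M
  have hprime : M.primeCompl ≤ nonZeroDivisors (MvPolynomial ι k ⧸ I) :=
    Ideal.primeCompl_le_nonZeroDivisors M
  have hdom : IsDomain O := IsLocalization.isDomain_localization hprime
  have hnoeth : IsNoetherianRing O := IsLocalization.isNoetherianRing M.primeCompl O inferInstance
  have hprinc : (IsLocalRing.maximalIdeal O).IsPrincipal := by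
    have hmap : M.map (algebraMap _ O) = IsLocalRing.maximalIdeal O :=
      Localization.AtPrime.map_eq_maximalIdeal
    have h1 := Ideal.map_mono (f := algebraMap (MvPolynomial ι k ⧸ I) O) hle
    rw [Ideal.map_sup, Ideal.map_mul, hmap, Ideal.map_span, Set.image_singleton] at h1
    have h2 : IsLocalRing.maximalIdeal O ≤ Ideal.span {algebraMap _ O y} :=
      IsLocalRing.maximalIdeal_le_span_singleton (R := O) h1
    refine ⟨algebraMap _ O y, le_antisymm h2 ?_⟩
    rw [Submodule.span_singleton_le_iff_mem, ← hmap]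
    refine Ideal.mem_map_of_mem _ ?_
    rw [hspan]
    exact sum_mem fun j _ => Ideal.mul_mem_left _ _ (Ideal.subset_span ⟨j, rfl⟩)
  have hval : ValuationRing O :=
    ((tfae_of_isNoetherianRing_of_isLocalRing_of_isDomain O).out 4 1).1 hprinc
  have hpre : PreValuationRing O := hval.toPreValuationRing
  have hinj : Function.Injective (algebraMap (MvPolynomial ι k ⧸ I) O) :=
    IsLocalization.injective O hprime
  obtain ⟨⟨a, b⟩, hab⟩ := IsLocalization.surj (nonZeroDivisors (MvPolynomial ι k ⧸ I)) h
  have hb : algebraMap _ (FractionRing (MvPolynomial ι k ⧸ I)) (b : MvPolynomial ι k ⧸ I) ≠ 0 :=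
    IsFractionRing.to_map_ne_zero_of_mem_nonZeroDivisors b.2
  obtain ⟨c, hc⟩ := PreValuationRing.cond (algebraMap _ O a)
    (algebraMap _ O (b : MvPolynomial ι k ⧸ I))
  obtain ⟨⟨p, q⟩, hpq⟩ := IsLocalization.surj M.primeCompl c
  simp only at hab hpq
  obtain ⟨p', hp'⟩ := Ideal.Quotient.mk_surjective p
  obtain ⟨q', hq'⟩ := Ideal.Quotient.mk_surjective (q : MvPolynomial ι k ⧸ I)
  refine ⟨p', q', fun h0 => q.2 ?_, ?_⟩
  · rw [← hq']; exact (hM q').2 h0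
  rw [hp', hq']
  rcases hc with hc | hc
  · right
    have hR : a * p = b * q := hinj (by rw [map_mul, map_mul, ← hpq, ← mul_assoc, hc])
    apply mul_left_cancel₀ hb
    rw [← map_mul, ← hR, map_mul, ← hab]
    ring
  · left
    have hR : b * p = a * q := hinj (by rw [map_mul, map_mul, ← hpq, ← mul_assoc, hc])
    apply mul_left_cancel₀ hb
    rw [← map_mul, hR, map_mul, ← hab]
    ring

end JacobianCriterion

section ValuesAtPlaces

open Polynomial

variable {k F : Type*} [Field k] [Field F] [Algebra k F]

theorem ValuationSubring.mem_nonunits_of_mul_mem {V : ValuationSubring F} {x y : F}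
    (hy : y ∉ V.nonunits) (h : x * y ∈ V.nonunits) : x ∈ V.nonunits := by
  rw [ValuationSubring.mem_nonunits_iff_or, not_or, not_not] at hy
  simpa [mul_comm, hy.1] using V.mul_mem_nonunits hy.2 h

theorem ValuationSubring.sub_mem_nonunits_of_mul_pow_eq {V : ValuationSubring F}
    (hV : ∀ c : k, algebraMap k F c ∈ V) {t : F} {u : k} (hu : u ≠ 0)
    (ht : t - algebraMap k F u ∈ V.nonunits) {h : F} {N : ℕ} {p : k[X]}
    (e : h * t ^ N = aeval t p) :
    h - algebraMap k F (p.eval u * u⁻¹ ^ N) ∈ V.nonunits := by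
  have htu : t ^ N - algebraMap k F (u ^ N) ∈ V.nonunits := by
    simpa using aeval_sub_mem_nonunits hV ht (X ^ N)
  refine mem_nonunits_of_mul_mem
    (notMem_nonunits_of_sub_mem_nonunits hV (pow_ne_zero N hu) htu) ?_
  have := V.nonunits.sub_mem (aeval_sub_mem_nonunits hV ht p)
    (V.mul_mem_nonunits (hV (p.eval u * u⁻¹ ^ N)) htu)
  convert this using 1
  rw [sub_mul, e, mul_sub, ← map_mul, mul_assoc, ← mul_pow, inv_mul_cancel₀ hu, one_pow, mul_one]
  ring

theorem ValuationSubring.mem_nonunits_comap (V : ValuationSubring F) (σ : F ≃+* F) {x : F} :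
    x ∈ (V.comap σ.toRingHom).nonunits ↔ σ x ∈ V.nonunits := by
  rw [mem_nonunits_iff_or, mem_nonunits_iff_or, mem_comap]
  simp

theorem IntermediateField.adjoin_simple_mul_eq_top {s : F}
    (hs : IntermediateField.adjoin k {s} = ⊤) {a : k} (ha : a ≠ 0) :
    IntermediateField.adjoin k {algebraMap k F a * s} = ⊤ := by
  rw [eq_top_iff, ← hs, IntermediateField.adjoin_simple_le_iff]
  simpa [ha] using mul_mem (IntermediateField.algebraMap_mem _ a⁻¹)
    (IntermediateField.mem_adjoin_simple_self k (algebraMap k F a * s))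

theorem IntermediateField.adjoin_simple_map_eq_top {s : F}
    (hs : IntermediateField.adjoin k {s} = ⊤) (τ : k ≃+* k) (σ : F ≃+* F)
    (hσ : ∀ c, σ (algebraMap k F c) = algebraMap k F (τ c)) :
    IntermediateField.adjoin k {σ s} = ⊤ := by
  rw [eq_top_iff]
  intro x _
  obtain ⟨p, q, hpq⟩ := (IntermediateField.mem_adjoin_simple_iff k (σ.symm x)).1
    (hs ▸ IntermediateField.mem_top : σ.symm x ∈ IntermediateField.adjoin k {s})
  have key : ∀ p : k[X], σ (aeval s p) = aeval (σ s) (p.map (τ : k →+* k)) := by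
    intro p
    rw [aeval_def, aeval_def, eval₂_map, ← RingEquiv.coe_toRingHom, hom_eval₂]
    congr 1
    ext c
    simp [hσ]
  refine (IntermediateField.mem_adjoin_simple_iff k x).2
    ⟨p.map (τ : k →+* k), q.map (τ : k →+* k), ?_⟩
  rw [← key, ← key, ← map_div₀, ← hpq, RingEquiv.apply_symm_apply]

/-- If every function or its inverse is regular at the point `P`, then at most one valuation
subring is centred at `P`. -/
theorem ValuationSubring.le_of_centre {ι : Type*} {x : ι → F} {P : ι → k}
    (hreg : ∀ h : F, ∃ p q : MvPolynomial ι k, MvPolynomial.eval P q ≠ 0 ∧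
      (h * MvPolynomial.aeval x q = MvPolynomial.aeval x p ∨
        h * MvPolynomial.aeval x p = MvPolynomial.aeval x q))
    {V V' : ValuationSubring F}
    (hV : ∀ c : k, algebraMap k F c ∈ V) (hV' : ∀ c : k, algebraMap k F c ∈ V')
    (hx : ∀ i, x i - algebraMap k F (P i) ∈ V.nonunits)
    (hx' : ∀ i, x i - algebraMap k F (P i) ∈ V'.nonunits) : V ≤ V' := by
  intro h hh
  obtain ⟨p, q, hq, e | e⟩ := hreg h
  · exact V'.mem_of_mul_eq
      (notMem_nonunits_of_sub_mem_nonunits hV' hq (mvAeval_sub_mem_nonunits hV' hx' q))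
      (mem_of_sub_mem_nonunits hV' (mvAeval_sub_mem_nonunits hV' hx' p)) e
  · have hp : MvPolynomial.eval P p ≠ 0 := by
      intro hp
      refine notMem_nonunits_of_sub_mem_nonunits hV hq (mvAeval_sub_mem_nonunits hV hx q) ?_
      rw [← e]
      exact V.mul_mem_nonunits hh (by simpa [hp] using mvAeval_sub_mem_nonunits hV hx p)
    exact V'.mem_of_mul_eq
      (notMem_nonunits_of_sub_mem_nonunits hV' hp (mvAeval_sub_mem_nonunits hV' hx' p))
      (mem_of_sub_mem_nonunits hV' (mvAeval_sub_mem_nonunits hV' hx' q)) e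

end ValuesAtPlaces

namespace AffineCurve

open Polynomial

variable {K} {n : ℕ} (C : AffineCurve K n)

theorem constMap_eq_algebraMap (c : AlgebraicClosure K) :
    C.constMap c = algebraMap (AlgebraicClosure K) C.FunField c := by
  rw [IsScalarTower.algebraMap_apply (AlgebraicClosure K) C.CoordRing C.FunField]
  rfl

theorem aeval_xcoord (g : MvPolynomial (Fin n) (AlgebraicClosure K)) :
    MvPolynomial.aeval C.xcoord g =
      algebraMap C.CoordRing C.FunField (Ideal.Quotient.mk C.idealBar g) := by
  induction g using MvPolynomial.induction_on with
  | C a => rw [MvPolynomial.aeval_C, ← constMap_eq_algebraMap]; rfl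
  | add p q hp hq => simp only [map_add, hp, hq]
  | mul_X p i hp => simp only [map_mul, hp, MvPolynomial.aeval_X]; rfl

theorem aeval_xcoord_eq_zero_iff (g : MvPolynomial (Fin n) (AlgebraicClosure K)) :
    MvPolynomial.aeval C.xcoord g = 0 ↔ g ∈ C.idealBar := by
  rw [aeval_xcoord, FaithfulSMul.algebraMap_eq_zero_iff, Ideal.Quotient.eq_zero_iff_mem]

theorem adjoin_simple_eq_top {t : C.FunField}
    (ht : Subfield.closure (Set.range C.constMap ∪ {t}) = ⊤) :
    IntermediateField.adjoin (AlgebraicClosure K) {t} = ⊤ := by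
  rw [eq_top_iff]
  intro x _
  have hx : x ∈ Subfield.closure (Set.range C.constMap ∪ {t}) := ht ▸ Subfield.mem_top x
  have hr : Set.range C.constMap = Set.range (algebraMap (AlgebraicClosure K) C.FunField) :=
    congrArg Set.range (funext C.constMap_eq_algebraMap)
  rw [hr] at hx
  exact hx

theorem eval_algebraMap_eq_zero {P : Fin n → K} (hP : C.OnCurve P)
    {g : MvPolynomial (Fin n) (AlgebraicClosure K)} (hg : g ∈ C.idealBar) :
    MvPolynomial.eval (fun i => algebraMap K (AlgebraicClosure K) (P i)) g = 0 := by
  suffices h : C.idealBar ≤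
      RingHom.ker (MvPolynomial.eval fun i => algebraMap K (AlgebraicClosure K) (P i)) from h hg
  refine Ideal.map_le_iff_le_comap.2 fun f hf => ?_
  rw [Ideal.mem_comap, RingHom.mem_ker, MvPolynomial.eval_map, ← Function.comp_def,
    ← MvPolynomial.eval₂_comp, hP f hf, map_zero]

theorem map_idealBar (σ : AlgebraicClosure K ≃ₐ[K] AlgebraicClosure K) :
    C.idealBar = C.idealBar.map
      (MvPolynomial.mapEquiv (Fin n) σ.toRingEquiv : _ →+* MvPolynomial (Fin n) _) := by
  unfold idealBar
  rw [Ideal.map_map]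
  congr 1
  ext x
  · simp
  · simp

/-- The action of the absolute Galois group of `K` on the function field `K̄(C)`. -/
def galoisEquiv (σ : AlgebraicClosure K ≃ₐ[K] AlgebraicClosure K) : C.FunField ≃+* C.FunField :=
  IsFractionRing.ringEquivOfRingEquiv (Ideal.quotientEquiv C.idealBar C.idealBar
    (MvPolynomial.mapEquiv (Fin n) σ.toRingEquiv) (C.map_idealBar σ))

theorem galoisEquiv_algebraMap_mk (σ : AlgebraicClosure K ≃ₐ[K] AlgebraicClosure K)
    (g : MvPolynomial (Fin n) (AlgebraicClosure K)) :
    C.galoisEquiv σ (algebraMap C.CoordRing C.FunField (Ideal.Quotient.mk C.idealBar g)) =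
      algebraMap C.CoordRing C.FunField
        (Ideal.Quotient.mk C.idealBar (MvPolynomial.mapEquiv (Fin n) σ.toRingEquiv g)) := by
  rw [galoisEquiv, IsFractionRing.ringEquivOfRingEquiv_algebraMap, Ideal.quotientEquiv_mk]

theorem galoisEquiv_xcoord (σ : AlgebraicClosure K ≃ₐ[K] AlgebraicClosure K) (i : Fin n) :
    C.galoisEquiv σ (C.xcoord i) = C.xcoord i := by
  rw [xcoord, galoisEquiv_algebraMap_mk]
  simp

theorem galoisEquiv_algebraMap (σ : AlgebraicClosure K ≃ₐ[K] AlgebraicClosure K)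
    (c : AlgebraicClosure K) :
    C.galoisEquiv σ (algebraMap _ C.FunField c) = algebraMap _ C.FunField (σ c) := by
  rw [← constMap_eq_algebraMap, ← constMap_eq_algebraMap]
  change C.galoisEquiv σ (algebraMap C.CoordRing C.FunField
    (Ideal.Quotient.mk C.idealBar (MvPolynomial.C c))) = _
  rw [galoisEquiv_algebraMap_mk]
  simp [constMap]

theorem fixesKC_galoisEquiv (σ : AlgebraicClosure K ≃ₐ[K] AlgebraicClosure K) :
    C.FixesKC (C.galoisEquiv σ) := by
  refine ⟨fun a => ?_, C.galoisEquiv_xcoord σ⟩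
  rw [constMapK, RingHom.comp_apply, constMap_eq_algebraMap, galoisEquiv_algebraMap, σ.commutes]

/-- Every rational function or its inverse is regular at a non-singular point. -/
theorem IsNonsingularPoint.regular_or_inv_regular {C : AffineCurve K n} {P : Fin n → K}
    (hP : C.IsNonsingularPoint P) (h : C.FunField) :
    ∃ p q : MvPolynomial (Fin n) (AlgebraicClosure K),
      MvPolynomial.eval (fun i => algebraMap K (AlgebraicClosure K) (P i)) q ≠ 0 ∧
      (h * MvPolynomial.aeval C.xcoord q = MvPolynomial.aeval C.xcoord p ∨
        h * MvPolynomial.aeval C.xcoord p = MvPolynomial.aeval C.xcoord q) := by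
  obtain ⟨hPC, hrank⟩ := hP
  let G : MvPolynomial (Fin n) K →ₗ[K] (Fin n → K) :=
    LinearMap.pi fun i => (MvPolynomial.aeval P).toLinearMap ∘ₗ (MvPolynomial.pderiv i).toLinearMap
  have hG : ∀ f i, G f i = MvPolynomial.eval P (MvPolynomial.pderiv i f) := fun f i => by
    simp [G, MvPolynomial.aeval_eq_eval]
  let W := (C.J.restrictScalars K).map G
  have hW : Module.finrank K W = n - 1 := by
    have hset : (W : Set (Fin n → K)) =
        {g | ∃ f ∈ C.J, g = fun i => MvPolynomial.eval P (MvPolynomial.pderiv i f)} := by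
      refine Set.ext fun g => ⟨?_, ?_⟩
      · rintro ⟨f, hf, rfl⟩
        exact ⟨f, hf, funext (hG f)⟩
      · rintro ⟨f, hf, rfl⟩
        exact ⟨f, hf, funext (hG f)⟩
    rw [← hrank, ← hset, Submodule.span_eq]
  have hquot : Module.finrank K ((Fin n → K) ⧸ W) ≤ 1 := by
    have := W.finrank_quotient_add_finrank
    rw [hW, Module.finrank_fin_fun] at this
    omega
  obtain ⟨e', he'⟩ := finrank_le_one_iff.1 hquot
  obtain ⟨e, rfl⟩ := W.mkQ_surjective e'
  simp only [aeval_xcoord]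
  refine regular_or_inv_regular_of_gradients C.idealBar _
    (fun f hf => C.eval_algebraMap_eq_zero hPC hf)
    (fun i => algebraMap K (AlgebraicClosure K) (e i)) (fun i => ?_) h
  obtain ⟨c, hc⟩ := he' (W.mkQ (Pi.single i 1))
  rw [← map_smul, eq_comm, ← sub_eq_zero, ← map_sub, Submodule.mkQ_apply,
    Submodule.Quotient.mk_eq_zero] at hc
  obtain ⟨f, hf, hfe⟩ := hc
  refine ⟨algebraMap K _ c, MvPolynomial.map (algebraMap K (AlgebraicClosure K)) f,
    Ideal.mem_map_of_mem _ hf, funext fun j => ?_⟩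
  have hj := congrArg (algebraMap K (AlgebraicClosure K)) (congrFun hfe j)
  rw [hG] at hj
  have hs : algebraMap K (AlgebraicClosure K) ((Pi.single i 1 : Fin n → K) j) =
      (Pi.single i 1 : Fin n → AlgebraicClosure K) j := by
    simp [Pi.single_apply, apply_ite (algebraMap K (AlgebraicClosure K))]
  rw [Pi.sub_apply, map_sub, hs, eq_sub_iff_add_eq] at hj
  rw [← hj]
  change _ = algebraMap K (AlgebraicClosure K) c * algebraMap K (AlgebraicClosure K) (e j) +
    MvPolynomial.eval _ (MvPolynomial.pderiv j (MvPolynomial.map _ f))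
  rw [MvPolynomial.pderiv_map, MvPolynomial.eval_map, MvPolynomial.eval₂_comp, Pi.smul_apply,
    smul_eq_mul, map_mul, add_comm]
  rfl

theorem mem_range_algebraMap_of_forall_fixed {c : AlgebraicClosure K}
    (hc : ∀ σ : AlgebraicClosure K ≃ₐ[K] AlgebraicClosure K, σ c = c) :
    c ∈ (algebraMap K (AlgebraicClosure K)).range :=
  IntermediateField.mem_bot.1 ((InfiniteGalois.mem_bot_iff_fixed c).2 hc)

/-- There is a coordinate `t` on the curve with pole `A` and zero `B`, invariant under the Galois
group, taking the value `1` at a place centred at the non-singular point `P`. -/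
theorem exists_invariant_coordinate {A B : ValuationSubring C.FunField} (hAB : A ≠ B)
    (hgenus : C.GenusZero) (hinf : ∀ V, C.IsPointAtInfinity V ↔ V = A ∨ V = B)
    (hdefA : C.DefinedOverK A) (hdefB : C.DefinedOverK B) {P : Fin n → K}
    (hP : C.IsNonsingularPoint P) :
    ∃ t : C.FunField, IntermediateField.adjoin (AlgebraicClosure K) {t} = ⊤ ∧ t ∉ A ∧
      t ∈ B.nonunits ∧ (∀ σ, C.galoisEquiv σ t = t) ∧
      ∃ V : ValuationSubring C.FunField,
        (∀ c, algebraMap (AlgebraicClosure K) C.FunField c ∈ V) ∧ t - 1 ∈ V.nonunits ∧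
        ∀ i, C.xcoord i - algebraMap (AlgebraicClosure K) _ (algebraMap K _ (P i)) ∈
          V.nonunits := by
  obtain ⟨⟨hA, hA'⟩, j, hjA⟩ := (hinf A).2 (Or.inl rfl)
  obtain ⟨⟨hB, hB'⟩, -⟩ := (hinf B).2 (Or.inr rfl)
  simp only [constMap_eq_algebraMap] at hA hB
  obtain ⟨s, hs⟩ := hgenus
  obtain ⟨t, ht, htA, htB⟩ :=
    exists_generator_pole_zero (C.adjoin_simple_eq_top hs) hA hB hA' hB' hAB
  obtain ⟨V, hxV, hPV⟩ := exists_valuationSubring_of_ker_le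
    (MvPolynomial.aeval C.xcoord : _ →ₐ[AlgebraicClosure K] C.FunField).toRingHom
    (MvPolynomial.eval fun i => algebraMap K (AlgebraicClosure K) (P i))
    fun g hg => C.eval_algebraMap_eq_zero hP.1 ((C.aeval_xcoord_eq_zero_iff g).1 hg)
  have hV : ∀ c, algebraMap (AlgebraicClosure K) C.FunField c ∈ V := fun c => by
    have := hxV (MvPolynomial.C c)
    rwa [AlgHom.toRingHom_eq_coe, RingHom.coe_coe, MvPolynomial.aeval_C] at this
  have hx : ∀ i, C.xcoord i - algebraMap (AlgebraicClosure K) _ (algebraMap K _ (P i)) ∈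
      V.nonunits := fun i => by
    have := hPV (MvPolynomial.X i - MvPolynomial.C (algebraMap K _ (P i))) (by simp)
    rwa [AlgHom.toRingHom_eq_coe, RingHom.coe_coe, map_sub, MvPolynomial.aeval_X,
      MvPolynomial.aeval_C] at this
  have hVtop : V ≠ ⊤ := by
    rintro rfl
    rcases (ValuationSubring.mem_nonunits_iff_or _).1 (hx j) with h0 | h0
    · exact hjA (sub_eq_zero.1 h0 ▸ hA _)
    · exact h0 (ValuationSubring.mem_top _)
  have hVinf : ¬ (V = A ∨ V = B) := fun h => by
    obtain ⟨-, i, hi⟩ := (hinf V).2 h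
    exact hi (ValuationSubring.mem_of_sub_mem_nonunits hV (hx i))
  push Not at hVinf
  have htV : t ∈ V := by
    by_contra htV
    exact hVinf.1 (ValuationSubring.eq_of_generator_notMem ht hV hA htV htA)
  obtain ⟨a, ha⟩ := ValuationSubring.exists_sub_mem_nonunits ht hV hVtop htV
  have ha0 : a ≠ 0 := by
    rintro rfl
    have htB0 : t - algebraMap (AlgebraicClosure K) C.FunField 0 ∈ B.nonunits := by simpa using htB
    exact hVinf.2 (le_antisymm (ValuationSubring.le_of_sub_mem_nonunits ht hV hB ha htB0)
      (ValuationSubring.le_of_sub_mem_nonunits ht hB hV htB0 ha))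
  refine ⟨algebraMap _ _ a⁻¹ * t, IntermediateField.adjoin_simple_mul_eq_top ht (inv_ne_zero ha0),
    fun h => htA ?_, B.mul_mem_nonunits (hB _) htB, fun σ => ?_, V, hV, ?_, hx⟩
  · have := A.mul_mem _ _ (hA a) h
    rwa [← mul_assoc, ← map_mul, mul_inv_cancel₀ ha0, map_one, one_mul] at this
  · have hfix := C.fixesKC_galoisEquiv σ
    have hσA : C.galoisEquiv σ t ∉ A := fun h => htA (hdefA _ hfix ▸ h)
    have hσB : C.galoisEquiv σ t ∈ B.nonunits := by
      rw [← ValuationSubring.mem_nonunits_comap, hdefB _ hfix]; exact htB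
    obtain ⟨c, hc, hct⟩ := exists_eq_mul_of_pole_zero hA hB ht
      (IntermediateField.adjoin_simple_map_eq_top ht σ.toRingEquiv (C.galoisEquiv σ)
        (C.galoisEquiv_algebraMap σ)) htA hσA htB hσB
    have hV' : ∀ c, algebraMap (AlgebraicClosure K) C.FunField c ∈
        V.comap (C.galoisEquiv σ).toRingHom := fun c => by
      rw [ValuationSubring.mem_comap]
      exact (C.galoisEquiv_algebraMap σ c).symm ▸ hV (σ c)
    have hx' : ∀ i, C.xcoord i - algebraMap (AlgebraicClosure K) _ (algebraMap K _ (P i)) ∈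
        (V.comap (C.galoisEquiv σ).toRingHom).nonunits := fun i => by
      rw [ValuationSubring.mem_nonunits_comap, map_sub, galoisEquiv_xcoord,
        galoisEquiv_algebraMap, σ.commutes]
      exact hx i
    have hVV : V.comap (C.galoisEquiv σ).toRingHom = V := le_antisymm
      (ValuationSubring.le_of_centre hP.regular_or_inv_regular hV' hV hx' hx)
      (ValuationSubring.le_of_centre hP.regular_or_inv_regular hV hV' hx hx')
    have haσ := ha
    rw [← hVV, ValuationSubring.mem_nonunits_comap, map_sub, galoisEquiv_algebraMap, hct] at haσ
    have hca : c * a = σ a := by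
      rw [← sub_eq_zero]
      refine neg_eq_zero.1 (ValuationSubring.eq_zero_of_algebraMap_mem_nonunits hV ?_)
      have := V.nonunits.sub_mem (V.mul_mem_nonunits (hV c) ha) haσ
      rw [mul_sub, ← map_mul, sub_sub_sub_cancel_left, ← map_sub] at this
      simpa using this
    rw [map_mul, galoisEquiv_algebraMap, hct, map_inv₀ σ, ← hca, ← mul_assoc, ← map_mul]
    congr 2
    field_simp
  · have := V.mul_mem_nonunits (hV a⁻¹) ha
    rwa [mul_sub, ← map_mul, inv_mul_cancel₀ ha0, map_one] at this

/-- A curve of genus `0` with two rational points at infinity and a non-singular rational point is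
parametrised over `K` by Laurent polynomials. -/
theorem exists_laurent_parametrization {A B : ValuationSubring C.FunField} (hAB : A ≠ B)
    (hgenus : C.GenusZero) (hinf : ∀ V, C.IsPointAtInfinity V ↔ V = A ∨ V = B)
    (hdefA : C.DefinedOverK A) (hdefB : C.DefinedOverK B) {P : Fin n → K}
    (hP : C.IsNonsingularPoint P) :
    ∃ (p : Fin n → K[X]) (N : ℕ), (∀ i, (p i).eval 1 = P i) ∧
      (∀ u : K, u ≠ 0 → C.OnCurve fun i => (p i).eval u * u⁻¹ ^ N) ∧
      ∃ i, ∀ b : K, p i ≠ Polynomial.C b * X ^ N := by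
  obtain ⟨t, ht, htA, htB, htσ, V, hV, htV, hxV⟩ :=
    C.exists_invariant_coordinate hAB hgenus hinf hdefA hdefB hP
  obtain ⟨⟨hA, hA'⟩, j, hjA⟩ := (hinf A).2 (Or.inl rfl)
  simp only [constMap_eq_algebraMap] at hA
  have htt := transcendental_of_notMem hA htA
  have ht0 : t ≠ 0 := fun h => htA (h ▸ A.zero_mem)
  have hinj : Function.Injective (aeval t : (AlgebraicClosure K)[X] → C.FunField) :=
    transcendental_iff_injective.1 htt
  choose M r hr using fun i => exists_mul_pow_eq_aeval_of_forall_mem (h := C.xcoord i) htt ht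
    fun W hW hW' htW htW' => by
      by_contra hi
      rcases (hinf W).1 ⟨⟨fun c => C.constMap_eq_algebraMap c ▸ hW c, hW'⟩, i, hi⟩ with rfl | rfl
      · exact htA htW
      · exact htW' htB
  let N := ∑ i, M i
  have hN : ∀ i, M i ≤ N := fun i =>
    Finset.single_le_sum (fun _ _ => Nat.zero_le _) (Finset.mem_univ i)
  have hq : ∀ i, C.xcoord i * t ^ N = aeval t (r i * X ^ (N - M i)) := fun i => by
    rw [map_mul, ← hr i, map_pow, aeval_X, mul_assoc, ← pow_add, Nat.add_sub_cancel' (hN i)]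
  have hlift : ∀ i, ∃ p : K[X], p.map (algebraMap K (AlgebraicClosure K)) =
      r i * X ^ (N - M i) := fun i => by
    refine (mem_lifts _).1 ((lifts_iff_coeff_lifts _).2 fun m => ?_)
    refine mem_range_algebraMap_of_forall_fixed fun σ => ?_
    have h1 := congrArg (C.galoisEquiv σ) (hq i)
    rw [map_mul, map_pow, htσ, galoisEquiv_xcoord, hq i] at h1
    have h2 : C.galoisEquiv σ (aeval t (r i * X ^ (N - M i))) =
        aeval t ((r i * X ^ (N - M i)).map (σ : AlgebraicClosure K →+* AlgebraicClosure K)) := by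
      rw [aeval_def, aeval_def, eval₂_map, ← RingEquiv.coe_toRingHom, hom_eval₂]
      congr 1
      · ext c
        simp [galoisEquiv_algebraMap]
      · exact htσ σ
    have h3 := congrArg (fun f => coeff f m) (hinj (h1.trans h2))
    simp only [coeff_map] at h3
    exact h3.symm
  choose p hp using hlift
  have hval : ∀ (W : ValuationSubring C.FunField) (u : K),
      (∀ c, algebraMap (AlgebraicClosure K) C.FunField c ∈ W) → u ≠ 0 →
      t - algebraMap (AlgebraicClosure K) C.FunField (algebraMap K _ u) ∈ W.nonunits →
      ∀ i, C.xcoord i - algebraMap (AlgebraicClosure K) C.FunField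
        (algebraMap K _ ((p i).eval u * u⁻¹ ^ N)) ∈ W.nonunits := by
    intro W u hW hu htu i
    have := ValuationSubring.sub_mem_nonunits_of_mul_pow_eq hW
      (by simpa using hu : algebraMap K (AlgebraicClosure K) u ≠ 0) htu (hq i)
    rwa [← hp i, eval_map_algebraMap, aeval_algebraMap_apply, ← map_inv₀, ← map_pow,
      ← map_mul, coe_aeval_eq_eval] at this
  refine ⟨p, N, fun i => ?_, fun u hu f hf => ?_, j, fun b hb => hjA ?_⟩
  · have h1 := hval V 1 hV one_ne_zero (by simpa using htV) i
    have h2 := V.nonunits.sub_mem (hxV i) h1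
    rw [sub_sub_sub_cancel_left, ← map_sub, ← map_sub] at h2
    have h3 := ValuationSubring.eq_zero_of_algebraMap_mem_nonunits hV h2
    rw [map_eq_zero, inv_one, one_pow, mul_one, sub_eq_zero] at h3
    exact h3
  · obtain ⟨W, hW, -, htW⟩ := exists_valuationSubring_sub_mem_nonunits htt
      (algebraMap K (AlgebraicClosure K) u)
    have h1 := ValuationSubring.mvAeval_sub_mem_nonunits hW (hval W u hW hu htW)
      (MvPolynomial.map (algebraMap K (AlgebraicClosure K)) f)
    rw [(C.aeval_xcoord_eq_zero_iff _).2 (Ideal.mem_map_of_mem _ hf), zero_sub, ← map_neg] at h1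
    have h2 := neg_eq_zero.1 (ValuationSubring.eq_zero_of_algebraMap_mem_nonunits hW h1)
    rw [MvPolynomial.eval_map, ← Function.comp_def (algebraMap K (AlgebraicClosure K)),
      ← MvPolynomial.eval₂_comp, map_eq_zero] at h2
    exact h2
  · have h1 := hq j
    rw [← hp j, hb, Polynomial.map_mul, map_C, Polynomial.map_pow, map_X, map_mul, aeval_C,
      map_pow, aeval_X] at h1
    rw [mul_right_cancel₀ (pow_ne_zero N ht0) h1]
    exact hA _

end AffineCurve

/-- If `C` has genus `0`, exactly two points at infinity, both defined over `K`,
`|S| ≥ 2`, and `C` has a non-singular `S`-integral point, then `C` has infinitely many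
`S`-integral points. -/
theorem infinite_SIntegralPoints_of_two_rational_points_at_infinity
    (K : Type) [Field K] [NumberField K] (n : ℕ) (C : AffineCurve K n)
    (S : Finset (NFPlace K)) (hS : ∀ v : NumberField.InfinitePlace K, Sum.inl v ∈ S)
    (hcard : 2 ≤ S.card)
    (hgenus : C.GenusZero)
    (A B : ValuationSubring C.FunField) (hAB : A ≠ B)
    (hinf : ∀ V, C.IsPointAtInfinity V ↔ V = A ∨ V = B)
    (hdefA : C.DefinedOverK A) (hdefB : C.DefinedOverK B)
    (hP : ∃ P ∈ C.SIntegralPoints S, C.IsNonsingularPoint P) :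
    (C.SIntegralPoints S).Infinite := by
  obtain ⟨P, ⟨-, hPint⟩, hPns⟩ := hP
  obtain ⟨p, N, hp1, hcurve, i, hi⟩ :=
    C.exists_laurent_parametrization hAB hgenus hinf hdefA hdefB hPns
  have hU := infinite_setOf_SIntegral_values hcard p N fun i => (hp1 i).symm ▸ hPint i
  intro hfin
  refine hU (((hfin.preimage' (f := fun (u : K) i => (p i).eval u * u⁻¹ ^ N)
    fun Q _ => ?_)).subset fun u hu => ⟨hcurve u hu.1, hu.2⟩)
  have hne : p i - Polynomial.C (Q i) * Polynomial.X ^ N ≠ 0 := sub_ne_zero.2 (hi (Q i))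
  refine ((Polynomial.finite_setOfPred_isRoot hne).union (Set.finite_singleton 0)).subset
    fun u hu => ?_
  by_cases hu0 : u = 0
  · exact Or.inr hu0
  · left
    have h1 : (p i).eval u * u⁻¹ ^ N = Q i := congrFun hu i
    rw [Set.mem_ofPred_eq, Polynomial.IsRoot.def, Polynomial.eval_sub, Polynomial.eval_mul,
      Polynomial.eval_C, Polynomial.eval_pow, Polynomial.eval_X, ← h1, mul_assoc, ← mul_pow,
      inv_mul_cancel₀ hu0, one_pow, mul_one, sub_self]
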